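/- Let X_N be an N-dimensional subspace of C(Ω), 1 ≤ p < ∞, ξ = {ξ^1,…,ξ^m} ⊂ Ω, and w a positive weight satisfying assumption (A1): C_1‖u‖_p ≤ ‖S(u,ξ)‖_{p,w} for all u ∈ X_N, and assumption (A2): Σ_{ν=1}^m w_ν ≤ C_2. Let P_{X_N,∞}(f) ∈ X_N be a best uniform approximant of f from X_N. Then for every f ∈ C(Ω), ‖P_{X_N,∞}(f) − ℓpw(ξ)(f)‖_p ≤ 2 C_1^{-1} C_2^{1/p} · d(f, X_N)_∞. -/

import Mathlib

open MeasureTheory ENNReal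

noncomputable section

/-- The `L_p(Ω,μ)` norm `(∫ |f|^p dμ)^{1/p}` of a complex valued function. -/
def lpNormE {α : Type*} [MeasurableSpace α] (μ : Measure α) (p : ℝ) (f : α → ℂ) : ℝ≥0∞ :=
  (∫⁻ x, (‖f x‖₊ : ℝ≥0∞) ^ p ∂μ) ^ (1 / p)

/-- The uniform norm `max_{x ∈ Ω} |f(x)|` (as a supremum in `ℝ≥0∞`). -/
def supNormE {α : Type*} (f : α → ℂ) : ℝ≥0∞ :=
  ⨆ x, (‖f x‖₊ : ℝ≥0∞)

/-- The weighted discrete norm `‖S(f,ξ)‖_{p,w} = (∑_ν w_ν |f(ξ^ν)|^p)^{1/p}`. -/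
def wNormE {α : Type*} {m : ℕ} (p : ℝ) (w : Fin m → ℝ) (ξ : Fin m → α) (f : α → ℂ) : ℝ≥0∞ :=
  (∑ ν, ENNReal.ofReal (w ν) * (‖f (ξ ν)‖₊ : ℝ≥0∞) ^ p) ^ (1 / p)

/-- The best approximation `d(f, X)_∞ = inf_{u ∈ X} ‖f - u‖_∞` of `f` by elements of `X`
in the uniform norm. -/
def distInfE {α : Type*} [TopologicalSpace α] (f : C(α, ℂ)) (X : Submodule ℂ C(α, ℂ)) : ℝ≥0∞ :=
  ⨅ u : X, supNormE (fun x => f x - (u : C(α, ℂ)) x)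

theorem wNormE_le_add {α : Type*} {m : ℕ} {p : ℝ} (hp : 1 ≤ p) (w : Fin m → ℝ)
    (ξ : Fin m → α) {a b c : α → ℂ} (h : ∀ x, ‖a x‖₊ ≤ ‖b x‖₊ + ‖c x‖₊) :
    wNormE p w ξ a ≤ wNormE p w ξ b + wNormE p w ξ c := by
  have hp0 : 0 < p := by linarith
  have key : ∀ (t : ℝ) (x : ℝ≥0∞),
      ENNReal.ofReal t * x ^ p = (ENNReal.ofReal t ^ (1 / p) * x) ^ p := fun t x => by
    rw [ENNReal.mul_rpow_of_nonneg _ _ hp0.le, ← ENNReal.rpow_mul,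
      one_div_mul_cancel hp0.ne', ENNReal.rpow_one]
  simp only [wNormE, key]
  refine le_trans ?_ (ENNReal.Lp_add_le Finset.univ _ _ hp)
  gcongr with ν
  rw [← mul_add]
  gcongr
  exact_mod_cast h (ξ ν)

theorem wNormE_le_mul_supNormE {α : Type*} {m : ℕ} {p : ℝ} (hp : 0 < p) {w : Fin m → ℝ}
    (hw : ∀ ν, 0 ≤ w ν) (ξ : Fin m → α) {C : ℝ} (hC : ∑ ν, w ν ≤ C) (a : α → ℂ) :
    wNormE p w ξ a ≤ ENNReal.ofReal C ^ (1 / p) * supNormE a := by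
  have h : ∑ ν, ENNReal.ofReal (w ν) * (‖a (ξ ν)‖₊ : ℝ≥0∞) ^ p ≤
      ENNReal.ofReal C * supNormE a ^ p := by
    calc _ ≤ ∑ ν, ENNReal.ofReal (w ν) * supNormE a ^ p := by
          gcongr with ν
          exact le_iSup (fun x => (‖a x‖₊ : ℝ≥0∞)) (ξ ν)
      _ = ENNReal.ofReal (∑ ν, w ν) * supNormE a ^ p := by
          rw [← Finset.sum_mul, ENNReal.ofReal_sum_of_nonneg fun ν _ => hw ν]
      _ ≤ _ := by gcongr
  calc wNormE p w ξ a ≤ (ENNReal.ofReal C * supNormE a ^ p) ^ (1 / p) :=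
        ENNReal.rpow_le_rpow h (by positivity)
    _ = _ := by
        rw [ENNReal.mul_rpow_of_nonneg _ _ (by positivity), ← ENNReal.rpow_mul,
          mul_one_div_cancel hp.ne', ENNReal.rpow_one]

/-- Let `X_N` be an `N`-dimensional subspace of `C(Ω)`, `1 ≤ p < ∞`,
`ξ = {ξ^1,…,ξ^m} ⊆ Ω`, and `w` a positive weight satisfying the discretization
assumption (A1): `C₁ ‖u‖_p ≤ ‖S(u,ξ)‖_{p,w}` for all `u ∈ X_N`, and (A2): `∑_ν w_ν ≤ C₂`.
If `P_{X_N,∞}(f) ∈ X_N` is a best uniform approximant of `f` from `X_N`, then for every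
`f ∈ C(Ω)` the weighted least squares recovery
`ℓpw(ξ)(f) = argmin_{u ∈ X_N} ‖S(f-u,ξ)‖_{p,w}` (any minimizer `g`) satisfies
`‖P_{X_N,∞}(f) - ℓpw(ξ)(f)‖_p ≤ 2 C₁⁻¹ C₂^{1/p} d(f, X_N)_∞`. -/
theorem lp_norm_of_chebyshev_minus_least_squares
    {d : ℕ} (Ω : Set (Fin d → ℝ)) (hΩ : IsCompact Ω)
    (μ : Measure Ω) [IsProbabilityMeasure μ]
    (N : ℕ) (X : Submodule ℂ C(Ω, ℂ)) (hXdim : Module.finrank ℂ X = N)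
    (p : ℝ) (hp : 1 ≤ p)
    (m : ℕ) (ξ : Fin m → Ω) (w : Fin m → ℝ) (hw : ∀ ν, 0 < w ν)
    (C₁ : ℝ) (hC₁ : 0 < C₁)
    (hA1 : ∀ u ∈ X, ENNReal.ofReal C₁ * lpNormE μ p (fun x => u x) ≤
      wNormE p w ξ (fun x => u x))
    (C₂ : ℝ) (hC₂ : 0 < C₂) (hA2 : ∑ ν, w ν ≤ C₂)
    (f : C(Ω, ℂ))
    (gbest : C(Ω, ℂ)) (hgbest : gbest ∈ X)
    (hbest : supNormE (fun x => f x - gbest x) = distInfE f X)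
    (g : C(Ω, ℂ)) (hg : g ∈ X)
    (hmin : ∀ u ∈ X, wNormE p w ξ (fun x => f x - g x) ≤ wNormE p w ξ (fun x => f x - u x)) :
    lpNormE μ p (fun x => gbest x - g x) ≤
      ENNReal.ofReal (2 * C₁⁻¹ * C₂ ^ (1 / p)) * distInfE f X := by
  have hp0 : 0 < p := by linarith
  have htri : wNormE p w ξ (fun x => gbest x - g x) ≤
      wNormE p w ξ (fun x => f x - g x) + wNormE p w ξ (fun x => f x - gbest x) := by
    refine wNormE_le_add hp w ξ fun x => ?_
    simpa using nnnorm_sub_le (f x - g x) (f x - gbest x)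
  have hsup := wNormE_le_mul_supNormE hp0 (fun ν => (hw ν).le) ξ hA2 (fun x => f x - gbest x)
  rw [hbest] at hsup
  have hdisc : ENNReal.ofReal C₁ * lpNormE μ p (fun x => gbest x - g x) ≤
      2 * (ENNReal.ofReal C₂ ^ (1 / p) * distInfE f X) :=
    calc _ ≤ wNormE p w ξ (fun x => gbest x - g x) := hA1 (gbest - g) (X.sub_mem hgbest hg)
      _ ≤ _ := htri
      _ ≤ _ := by
        rw [two_mul]
        exact add_le_add ((hmin gbest hgbest).trans hsup) hsup
  have hC₁' : ENNReal.ofReal C₁ ≠ 0 := by simpa using hC₁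
  calc lpNormE μ p (fun x => gbest x - g x)
      = (ENNReal.ofReal C₁)⁻¹ * (ENNReal.ofReal C₁ * lpNormE μ p (fun x => gbest x - g x)) := by
        rw [← mul_assoc, ENNReal.inv_mul_cancel hC₁' ENNReal.ofReal_ne_top, one_mul]
    _ ≤ (ENNReal.ofReal C₁)⁻¹ * (2 * (ENNReal.ofReal C₂ ^ (1 / p) * distInfE f X)) := by gcongr
    _ = _ := by
        rw [ENNReal.ofReal_mul (by positivity), ENNReal.ofReal_mul (by positivity),
          ENNReal.ofReal_inv_of_pos hC₁, ← ENNReal.ofReal_rpow_of_pos hC₂, ENNReal.ofReal_ofNat]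
        ring

end
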